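/- arXiv:0804.0947 — 9 statements merged into one kernel-verified Lean document; each statement's English description precedes it below -/
import Mathlib

section
/- Let V be a k-linear representation of the Coxeter group W. Then the subspace V̄ = ∑_{s∈S} V^s (the sum over the simple reflections of their fixed-point subspaces) is invariant under W; that is, w·V̄ ⊆ V̄ for every w ∈ W. -/
/-- Let `V` be a `k`-linear representation of the Coxeter group `W`. Then the
subspace `V̄ = ∑_{s ∈ S} V^s` (the sum over the simple reflections of their fixed-point
subspaces) is invariant under `W`. -/
theorem dynkin_stmt0 {B W : Type*} [Group W] {M : CoxeterMatrix B}
    (cs : CoxeterSystem M W) {k : Type*} [Field k] [CharZero k]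
    {V : Type*} [AddCommGroup V] [Module k V] (ρ : Representation k W V)
    (Vbar : Submodule k V)
    (hVbar : Vbar = ⨆ i : B, LinearMap.eqLocus (ρ (cs.simple i)) LinearMap.id) :
    ∀ w : W, ∀ v ∈ Vbar, ρ w v ∈ Vbar := by
  have simple_mem (i : B) (v : V) (hv : v ∈ Vbar) : ρ (cs.simple i) v ∈ Vbar := by
    have hfixed : v + ρ (cs.simple i) v ∈
        LinearMap.eqLocus (ρ (cs.simple i)) LinearMap.id := by
      rw [LinearMap.mem_eqLocus, LinearMap.id_apply, map_add, ← Module.End.mul_apply,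
        ← map_mul, cs.simple_mul_simple_self, map_one, Module.End.one_apply, add_comm]
    have hsum : v + ρ (cs.simple i) v ∈ Vbar :=
      hVbar ▸ Submodule.mem_iSup_of_mem i hfixed
    exact (Submodule.add_mem_iff_right Vbar hv).mp hsum
  intro w
  induction w using cs.simple_induction_left with
  | one => simp
  | mul_simple_left w i ih =>
    intro v hv
    rw [map_mul, Module.End.mul_apply]
    exact simple_mem i _ (ih v hv)
end

section
/- Let w ∈ W. The image of the basis element w of k[W] in the quotient k[W]/(k[W])‾, where (k[W])‾ = ∑_{s∈S} k[W]^{Ad(s)} is formed with respect to the conjugation action, is nonzero if and only if ε(z) = 1 for every element z of the centraliser C_W(w) of w in W. -/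
/-- Conjugation by the group element `s`, as a `k`-linear endomorphism of the group algebra
`k[W]`: it sends `f` to `s * f * s⁻¹`. -/
noncomputable def adConj (k : Type*) [Field k] {W : Type*} [Group W] (s : W) :
    MonoidAlgebra k W →ₗ[k] MonoidAlgebra k W :=
  (LinearMap.mulRight k (MonoidAlgebra.of k W s⁻¹)).comp
    (LinearMap.mulLeft k (MonoidAlgebra.of k W s))

section adConj

variable {k W : Type*} [Field k] [Group W]

lemma adConj_apply (s : W) (f : MonoidAlgebra k W) :
    adConj k s f = MonoidAlgebra.of k W s * f * MonoidAlgebra.of k W s⁻¹ := rfl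

lemma adConj_one (f : MonoidAlgebra k W) : adConj k (1 : W) f = f := by
  rw [adConj_apply, inv_one, map_one, one_mul, mul_one]

lemma adConj_mul (s t : W) (f : MonoidAlgebra k W) :
    adConj k (s * t) f = adConj k s (adConj k t f) := by
  simp only [adConj_apply, mul_inv_rev, map_mul, mul_assoc]

lemma adConj_of (s w : W) :
    adConj k s (MonoidAlgebra.of k W w) = MonoidAlgebra.of k W (s * w * s⁻¹) := by
  simp only [adConj_apply, map_mul]

lemma adConj_of_mem_centralizer {w z : W} (hz : z ∈ Subgroup.centralizer {w}) :
    adConj k z (MonoidAlgebra.of k W w) = MonoidAlgebra.of k W w := by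
  rw [adConj_of, Subgroup.mem_centralizer_singleton_iff.mp hz, mul_inv_cancel_right]

/-- Modulo the elements fixed by some simple reflection, `W` acts by conjugation through the
sign character. -/
lemma adConj_sub_smul_mem {B : Type*} {M : CoxeterMatrix B} (cs : CoxeterSystem M W)
    (ε : W →* kˣ) (hε : ∀ i : B, ε (cs.simple i) = -1) (z : W) (f : MonoidAlgebra k W) :
    adConj k z f - (ε z : k) • f ∈
      ⨆ i : B, LinearMap.eqLocus (adConj k (cs.simple i)) LinearMap.id := by
  induction z using cs.simple_induction generalizing f with
  | simple i =>
    refine Submodule.mem_iSup_of_mem i ?_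
    rw [LinearMap.mem_eqLocus, hε i, LinearMap.id_apply, Units.val_neg, Units.val_one, neg_smul,
      one_smul, sub_neg_eq_add, map_add, ← adConj_mul, cs.simple_mul_simple_self, adConj_one,
      add_comm]
  | one => simp [adConj_one]
  | mul a b ha hb =>
    have h := Submodule.add_mem _ (ha (adConj k b f)) (Submodule.smul_mem _ (ε a : k) (hb f))
    rwa [smul_sub, smul_smul, sub_add_sub_cancel, ← adConj_mul, ← Units.val_mul, ← map_mul] at h

open Classical in
/-- The function supported on the conjugacy class of `w` whose value at `g * w * g⁻¹` is `χ g`,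
which is well defined if `χ` is trivial on the centralizer of `w`. -/
noncomputable def conjClassChar (χ : W →* kˣ) (w x : W) : k :=
  if h : ∃ g, g * w * g⁻¹ = x then (χ h.choose : k) else 0

lemma conjClassChar_conj {χ : W →* kˣ} {w : W}
    (hχ : ∀ z ∈ Subgroup.centralizer {w}, χ z = 1) (g : W) :
    conjClassChar χ w (g * w * g⁻¹) = χ g := by
  have h : ∃ g', g' * w * g'⁻¹ = g * w * g⁻¹ := ⟨g, rfl⟩
  rw [conjClassChar, dif_pos h]
  have hmem : g⁻¹ * h.choose ∈ Subgroup.centralizer {w} := by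
    rw [Subgroup.mem_centralizer_singleton_iff]
    have := congrArg (fun x ↦ g⁻¹ * x * h.choose) h.choose_spec
    simpa [mul_assoc] using this
  have := hχ _ hmem
  rw [map_mul, map_inv, inv_mul_eq_one] at this
  rw [this]

lemma conjClassChar_self {χ : W →* kˣ} {w : W}
    (hχ : ∀ z ∈ Subgroup.centralizer {w}, χ z = 1) : conjClassChar χ w w = 1 := by
  simpa using conjClassChar_conj hχ 1

lemma conjClassChar_mul_mul_inv {χ : W →* kˣ} {w : W}
    (hχ : ∀ z ∈ Subgroup.centralizer {w}, χ z = 1) (s x : W) :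
    conjClassChar χ w (s * x * s⁻¹) = χ s * conjClassChar χ w x := by
  by_cases h : ∃ g, g * w * g⁻¹ = x
  · obtain ⟨g, rfl⟩ := h
    rw [conjClassChar_conj hχ, ← Units.val_mul, ← map_mul, ← conjClassChar_conj hχ]
    simp only [mul_inv_rev, mul_assoc]
  · have h' : ¬ ∃ g, g * w * g⁻¹ = s * x * s⁻¹ := by
      rintro ⟨g, hg⟩
      refine h ⟨s⁻¹ * g, ?_⟩
      have := congrArg (fun y ↦ s⁻¹ * y * s) hg
      simpa [mul_assoc] using this
    rw [conjClassChar, conjClassChar, dif_neg h, dif_neg h', mul_zero]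

/-- The linear extension of `conjClassChar χ w` to the group algebra. -/
noncomputable def conjClassFunctional (χ : W →* kˣ) (w : W) : MonoidAlgebra k W →ₗ[k] k :=
  Finsupp.linearCombination k (conjClassChar χ w) ∘ₗ
    (MonoidAlgebra.coeffLinearEquiv k).toLinearMap

lemma conjClassFunctional_of (χ : W →* kˣ) (w x : W) :
    conjClassFunctional χ w (MonoidAlgebra.of k W x) = conjClassChar χ w x := by
  simp [conjClassFunctional, MonoidAlgebra.of_apply]

lemma conjClassFunctional_adConj {χ : W →* kˣ} {w : W}
    (hχ : ∀ z ∈ Subgroup.centralizer {w}, χ z = 1) (s : W) (f : MonoidAlgebra k W) :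
    conjClassFunctional χ w (adConj k s f) = χ s * conjClassFunctional χ w f := by
  induction f using MonoidAlgebra.induction_on with
  | of x =>
    rw [adConj_of, conjClassFunctional_of, conjClassFunctional_of, conjClassChar_mul_mul_inv hχ]
  | add f g hf hg => rw [map_add, map_add, map_add, hf, hg, mul_add]
  | smul r f hf => rw [map_smul, map_smul, map_smul, hf, smul_eq_mul, smul_eq_mul, mul_left_comm]

end adConj

/-- Let `w ∈ W`. The image of the basis element `w` of `k[W]` in the quotient
`k[W]/(k[W])‾`, where `(k[W])‾ = ∑_{s ∈ S} k[W]^{Ad(s)}` is formed with respect to the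
conjugation action, is nonzero if and only if `ε(z) = 1` for every element `z` of the
centraliser `C_W(w)` of `w` in `W`. -/
theorem dynkin_stmt2 {B W : Type*} [Group W] {M : CoxeterMatrix B}
    (cs : CoxeterSystem M W) {k : Type*} [Field k] [CharZero k]
    (ε : W →* kˣ) (hε : ∀ i : B, ε (cs.simple i) = -1)
    (kWbar : Submodule k (MonoidAlgebra k W))
    (hbar : kWbar = ⨆ i : B, LinearMap.eqLocus (adConj k (cs.simple i)) LinearMap.id)
    (w : W) :
    (Submodule.Quotient.mk (MonoidAlgebra.of k W w) : MonoidAlgebra k W ⧸ kWbar) ≠ 0 ↔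
      ∀ z ∈ Subgroup.centralizer {w}, ε z = 1 := by
  rw [ne_eq, Submodule.Quotient.mk_eq_zero, hbar]
  constructor
  · intro hw z hz
    by_contra hne
    have h := adConj_sub_smul_mem cs ε hε z (MonoidAlgebra.of k W w)
    rw [adConj_of_mem_centralizer hz] at h
    have h' : (1 - (ε z : k)) • MonoidAlgebra.of k W w ∈
        ⨆ i : B, LinearMap.eqLocus (adConj k (cs.simple i)) LinearMap.id := by
      rwa [sub_smul, one_smul]
    have hz_ne : 1 - (ε z : k) ≠ 0 :=
      sub_ne_zero.mpr fun h1 ↦ hne (Units.ext (by rw [← h1, Units.val_one]))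
    exact hw ((Submodule.smul_mem_iff _ hz_ne).mp h')
  · intro hχ hw
    have hle : ⨆ i : B, LinearMap.eqLocus (adConj k (cs.simple i)) LinearMap.id ≤
        LinearMap.ker (conjClassFunctional ε w) := by
      refine iSup_le fun i f hf ↦ ?_
      rw [LinearMap.mem_eqLocus, LinearMap.id_apply] at hf
      have h := conjClassFunctional_adConj hχ (cs.simple i) f
      rw [hf, hε i, Units.val_neg, Units.val_one, neg_one_mul] at h
      exact self_eq_neg.mp h
    have h0 := LinearMap.mem_ker.mp (hle hw)
    rw [conjClassFunctional_of, conjClassChar_self hχ] at h0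
    exact one_ne_zero h0
end

section
/- Suppose the Coxeter group W is finite. For each conjugacy class c of W such that ε is trivial on the centraliser C_W(w_c) of a chosen representative w_c ∈ c, the element A^{w_c} = ∑_{w'} ε(w')·w' w_c w'⁻¹ of k[W], where w' runs over a set of representatives of the left cosets W/C_W(w_c), is nonzero, and the collection of these elements, as c ranges over all conjugacy classes with ε trivial on the centraliser, is a k-basis of the sign-isotypic subspace k[W]^ε = {f ∈ k[W] : w f w⁻¹ = ε(w) f for all w ∈ W}. -/
/-- The sign-isotypic subspace `{f ∈ k[W] : w f w⁻¹ = ε(w) f for all w ∈ W}` of the group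
algebra `k[W]` for the conjugation action, where `ε : W → k` is a character. -/
noncomputable def signIsotypic (k : Type*) [Field k] (W : Type*) [Group W] (ε : W → k) :
    Submodule k (MonoidAlgebra k W) :=
  ⨅ w : W, LinearMap.eqLocus (adConj k w) (ε w • LinearMap.id)

theorem mem_signIsotypic_iff {k W : Type*} [Field k] [Group W] (ε : W → k)
    (f : MonoidAlgebra k W) :
    f ∈ signIsotypic k W ε ↔ ∀ w g : W, f.coeff (w⁻¹ * g * w) = ε w * f.coeff g := by
  simp only [signIsotypic, adConj, Submodule.mem_iInf, LinearMap.mem_eqLocus,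
    ← MonoidAlgebra.coeff_inj, Finsupp.ext_iff]
  simp [mul_assoc]

theorem CoxeterSystem.mul_self_eq_one_of_simple_eq_neg_one {B W R : Type*} [Group W]
    {M : CoxeterMatrix B} (cs : CoxeterSystem M W) [Monoid R] [HasDistribNeg R] (ε : W →* Rˣ)
    (hε : ∀ i : B, ε (cs.simple i) = -1) (w : W) : ε w * ε w = 1 := by
  induction w using cs.simple_induction_left with
  | one => simp
  | mul_simple_left w i hw => simp [hε, hw]

section TwistedClassSum

variable {k W : Type*} [Field k] [Group W]

/-- The sum of `ε(w) · w r w⁻¹` over representatives `w` of the left cosets of the centraliser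
of `r`. -/
noncomputable def twistedClassSum (ε : W →* kˣ) (r : W) : MonoidAlgebra k W :=
  ∑ᶠ x : W ⧸ Subgroup.centralizer {r},
    ((ε x.out : k)) • MonoidAlgebra.of k W (x.out * r * x.out⁻¹)

theorem conj_eq_conj_iff_mk_centralizer_eq {r v w : W} :
    v * r * v⁻¹ = w * r * w⁻¹ ↔
      (v : W ⧸ Subgroup.centralizer {r}) = (w : W ⧸ Subgroup.centralizer {r}) := by
  rw [QuotientGroup.eq, Subgroup.mem_centralizer_singleton_iff]
  constructor <;> intro h
  · calc v⁻¹ * w * r = v⁻¹ * (w * r * w⁻¹) * w := by group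
      _ = r * (v⁻¹ * w) := by rw [← h]; group
  · calc v * r * v⁻¹ = v * (r * (v⁻¹ * w)) * w⁻¹ := by group
      _ = w * r * w⁻¹ := by rw [← h]; group

variable [Finite W]

theorem coeff_twistedClassSum_conj (ε : W →* kˣ) {r : W}
    (hr : ∀ z ∈ Subgroup.centralizer {r}, ε z = 1) (w : W) :
    (twistedClassSum ε r).coeff (w * r * w⁻¹) = ε w := by
  classical
  have := Fintype.ofFinite (W ⧸ Subgroup.centralizer {r})
  rw [twistedClassSum, finsum_eq_sum_of_fintype, MonoidAlgebra.coeff_sum, Finsupp.finsetSum_apply,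
    Finset.sum_eq_single (w : W ⧸ Subgroup.centralizer {r})]
  · have hout : ((w : W ⧸ Subgroup.centralizer {r}).out : W ⧸ Subgroup.centralizer {r}) = w :=
      QuotientGroup.out_eq' _
    have hε := hr _ (QuotientGroup.eq.mp hout)
    rw [map_mul, map_inv, inv_mul_eq_one] at hε
    simp [conj_eq_conj_iff_mk_centralizer_eq.mpr hout, hε]
  · intro x _ hx
    have hne : x.out * r * x.out⁻¹ ≠ w * r * w⁻¹ := fun h =>
      hx ((QuotientGroup.out_eq' x).symm.trans (conj_eq_conj_iff_mk_centralizer_eq.mp h))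
    simp [Finsupp.single_eq_of_ne' hne]
  · simp

theorem twistedClassSum_ne_zero (ε : W →* kˣ) {r : W}
    (hr : ∀ z ∈ Subgroup.centralizer {r}, ε z = 1) : twistedClassSum ε r ≠ 0 := fun h => by
  simpa [h] using coeff_twistedClassSum_conj ε hr 1

theorem coeff_twistedClassSum_of_not_isConj (ε : W →* kˣ) {r g : W} (h : ¬ IsConj r g) :
    (twistedClassSum ε r).coeff g = 0 := by
  have := Fintype.ofFinite (W ⧸ Subgroup.centralizer {r})
  rw [twistedClassSum, finsum_eq_sum_of_fintype, MonoidAlgebra.coeff_sum, Finsupp.finsetSum_apply]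
  refine Finset.sum_eq_zero fun x _ => ?_
  have hne : x.out * r * x.out⁻¹ ≠ g := fun hx => h (isConj_iff.mpr ⟨_, hx⟩)
  simp [Finsupp.single_eq_of_ne' hne]

theorem twistedClassSum_mem_signIsotypic (ε : W →* kˣ) (hsq : ∀ w, ε w * ε w = 1) {r : W}
    (hr : ∀ z ∈ Subgroup.centralizer {r}, ε z = 1) :
    twistedClassSum ε r ∈ signIsotypic k W (fun w => (ε w : k)) := by
  rw [mem_signIsotypic_iff]
  intro w g
  by_cases hg : IsConj r g
  · obtain ⟨v, rfl⟩ := isConj_iff.mp hg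
    have hconj : w⁻¹ * (v * r * v⁻¹) * w = (w⁻¹ * v) * r * (w⁻¹ * v)⁻¹ := by group
    rw [hconj, coeff_twistedClassSum_conj ε hr, coeff_twistedClassSum_conj ε hr, map_mul, map_inv,
      inv_eq_of_mul_eq_one_left (hsq w), Units.val_mul]
  · have hg' : ¬ IsConj r (w⁻¹ * g * w) := fun h =>
      hg (h.trans (isConj_iff.mpr ⟨w, by group⟩))
    rw [coeff_twistedClassSum_of_not_isConj ε hg, coeff_twistedClassSum_of_not_isConj ε hg',
      mul_zero]

theorem coeff_twistedClassSum_of_mk_ne {rep : ConjClasses W → W}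
    (hrep : ∀ c, ConjClasses.mk (rep c) = c) (ε : W →* kˣ) {c : ConjClasses W} {g : W}
    (h : c ≠ ConjClasses.mk g) : (twistedClassSum ε (rep c)).coeff g = 0 :=
  coeff_twistedClassSum_of_not_isConj ε fun hc =>
    h ((hrep c).symm.trans (ConjClasses.mk_eq_mk_iff_isConj.mpr hc))

theorem linearIndependent_twistedClassSum {rep : ConjClasses W → W}
    (hrep : ∀ c, ConjClasses.mk (rep c) = c) (ε : W →* kˣ) :
    LinearIndependent k
      (fun c : {c : ConjClasses W // ∀ z ∈ Subgroup.centralizer {rep c}, ε z = 1} =>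
        twistedClassSum ε (rep c.1)) := by
  rw [linearIndependent_iff']
  intro s a ha c hc
  have hcoeff := congrArg (fun f : MonoidAlgebra k W => f.coeff (rep c.1)) ha
  simp only [MonoidAlgebra.coeff_sum, Finsupp.finsetSum_apply, MonoidAlgebra.coeff_smul_apply,
    MonoidAlgebra.coeff_zero, Finsupp.zero_apply] at hcoeff
  rw [Finset.sum_eq_single c] at hcoeff
  · have hone := coeff_twistedClassSum_conj ε c.2 1
    simp only [one_mul, inv_one, mul_one, map_one, Units.val_one] at hone
    simpa [hone] using hcoeff
  · intro d _ hd
    rw [coeff_twistedClassSum_of_mk_ne hrep ε (by rw [hrep]; exact Subtype.coe_ne_coe.mpr hd),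
      smul_zero]
  · exact fun h => absurd hc h

theorem eq_sum_of_mem_signIsotypic {rep : ConjClasses W → W}
    (hrep : ∀ c, ConjClasses.mk (rep c) = c) (ε : W →* kˣ) (hsq : ∀ w, ε w * ε w = 1)
    [Fintype {c : ConjClasses W // ∀ z ∈ Subgroup.centralizer {rep c}, ε z = 1}]
    {f : MonoidAlgebra k W} (hf : f ∈ signIsotypic k W (fun w => (ε w : k))) :
    f = ∑ c : {c : ConjClasses W // ∀ z ∈ Subgroup.centralizer {rep c}, ε z = 1},
      f.coeff (rep c.1) • twistedClassSum ε (rep c.1) := by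
  rw [mem_signIsotypic_iff] at hf
  ext g
  simp only [MonoidAlgebra.coeff_sum, Finsupp.finsetSum_apply, MonoidAlgebra.coeff_smul_apply,
    smul_eq_mul]
  obtain ⟨v, hv⟩ := isConj_iff.mp (ConjClasses.mk_eq_mk_iff_isConj.mp (hrep (ConjClasses.mk g)))
  have hfg : f.coeff g = f.coeff (rep (ConjClasses.mk g)) * ε v := by
    have hsq' : (ε v : k) * ε v = 1 := by simpa using congrArg Units.val (hsq v)
    have hfv := hf v g
    rw [show v⁻¹ * g * v = rep (ConjClasses.mk g) by
      rw [mul_assoc, inv_mul_eq_iff_eq_mul, ← eq_mul_inv_iff_mul_eq, hv]] at hfv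
    rw [hfv, mul_right_comm, hsq', one_mul]
  by_cases hc : ∀ z ∈ Subgroup.centralizer {rep (ConjClasses.mk g)}, ε z = 1
  · rw [Finset.sum_eq_single ⟨ConjClasses.mk g, hc⟩]
    · have hcoeff := coeff_twistedClassSum_conj ε hc v
      rw [hv] at hcoeff
      rw [hcoeff, hfg]
    · intro d _ hd
      rw [coeff_twistedClassSum_of_mk_ne hrep ε (fun h => hd (Subtype.ext h)), mul_zero]
    · simp
  · rw [Finset.sum_eq_zero, hfg]
    · push Not at hc
      obtain ⟨z, hz, hεz⟩ := hc
      have hfz := hf z (rep (ConjClasses.mk g))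
      rw [mul_assoc, ← Subgroup.mem_centralizer_singleton_iff.mp hz, inv_mul_cancel_left] at hfz
      have hzero : f.coeff (rep (ConjClasses.mk g)) = 0 := by
        by_contra hne
        exact hεz (Units.ext ((right_eq_mul₀ hne).mp hfz))
      rw [hzero, zero_mul]
    · intro d _
      rw [coeff_twistedClassSum_of_mk_ne hrep ε (fun h => hc (h ▸ d.2)), mul_zero]

end TwistedClassSum

/-- Suppose the Coxeter group `W` is finite.  For each conjugacy class `c` of `W`
such that `ε` is trivial on the centraliser `C_W(w_c)` of a chosen representative `w_c ∈ c`,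
the element `A^{w_c} = ∑_{w'} ε(w')·w' w_c w'⁻¹` of `k[W]` (the sum over a set of
representatives of the left cosets `W/C_W(w_c)`) is nonzero, and the collection of these
elements, as `c` ranges over all conjugacy classes with `ε` trivial on the centraliser, is a
`k`-basis of the sign-isotypic subspace `k[W]^ε`. -/
theorem dynkin_stmt4 {B W : Type*} [Group W] [Finite W] {M : CoxeterMatrix B}
    (cs : CoxeterSystem M W) {k : Type*} [Field k] [CharZero k]
    (ε : W →* kˣ) (hε : ∀ i : B, ε (cs.simple i) = -1)
    (rep : ConjClasses W → W) (hrep : ∀ c, ConjClasses.mk (rep c) = c)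
    (A : ConjClasses W → MonoidAlgebra k W)
    (hA : ∀ c, A c = ∑ᶠ x : W ⧸ Subgroup.centralizer {rep c},
      ((ε x.out : k)) • MonoidAlgebra.of k W (x.out * rep c * x.out⁻¹)) :
    (∀ c : ConjClasses W, (∀ z ∈ Subgroup.centralizer {rep c}, ε z = 1) → A c ≠ 0) ∧
    LinearIndependent k
      (fun c : {c : ConjClasses W // ∀ z ∈ Subgroup.centralizer {rep c}, ε z = 1} => A c.1) ∧
    Submodule.span k
      (Set.range
        (fun c : {c : ConjClasses W // ∀ z ∈ Subgroup.centralizer {rep c}, ε z = 1} =>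
          A c.1)) = signIsotypic k W (fun w => (ε w : k)) := by
  replace hA : A = fun c => twistedClassSum ε (rep c) := funext hA
  subst hA
  have hsq := cs.mul_self_eq_one_of_simple_eq_neg_one ε hε
  refine ⟨fun c hc => twistedClassSum_ne_zero ε hc,
    linearIndependent_twistedClassSum hrep ε, le_antisymm ?_ fun f hf => ?_⟩
  · rw [Submodule.span_le]
    rintro _ ⟨c, rfl⟩
    exact twistedClassSum_mem_signIsotypic ε hsq c.2
  · have := Finite.of_surjective _ (ConjClasses.mk_surjective (α := W))
    have := Fintype.ofFinite
      {c : ConjClasses W // ∀ z ∈ Subgroup.centralizer {rep c}, ε z = 1}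
    rw [eq_sum_of_mem_signIsotypic hrep ε hsq hf]
    exact Submodule.sum_mem _ fun c _ =>
      Submodule.smul_mem _ _ (Submodule.subset_span (Set.mem_range_self c))
end

section
/- Let m ≥ 3, let W be the dihedral group of order 2m, and let ε : W → kˣ be the group homomorphism with ε equal to 1 on all rotations r^i and equal to −1 on all reflections. Then the sign-isotypic subspace {f ∈ k[W] : w f w⁻¹ = ε(w) f for all w ∈ W} of the group algebra k[W] under the conjugation action has dimension ⌊(m−1)/2⌋ over k; a basis is given by the elements ∑_{w' ∈ W/C_W((st)^p)} ε(w')·w'(st)^p w'⁻¹ for p = 1, …, ⌊(m−1)/2⌋, where st = r. -/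
open DihedralGroup

theorem mem_signIsotypic {k W : Type*} [Field k] [Group W] {ε : W → k} {f : MonoidAlgebra k W} :
    f ∈ signIsotypic k W ε ↔ ∀ w g, f.coeff (w⁻¹ * g * w) = ε w * f.coeff g := by
  simp only [signIsotypic, Submodule.mem_iInf, LinearMap.mem_eqLocus, adConj,
    LinearMap.comp_apply, LinearMap.mulLeft_apply, LinearMap.mulRight_apply,
    LinearMap.smul_apply, LinearMap.id_apply, MonoidAlgebra.of_apply]
  refine forall_congr' fun w => ?_
  rw [← MonoidAlgebra.coeff_inj, Finsupp.ext_iff]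
  simp [mul_assoc]

/-- On the dihedral group, the sign-isotypic functions are those that vanish on the reflections
and are odd on the rotations. -/
theorem mem_signIsotypic_dihedralGroup {m : ℕ} {k : Type*} [Field k] [CharZero k]
    {ε : DihedralGroup m → k} (hεr : ∀ i, ε (r i) = 1) (hεsr : ∀ i, ε (sr i) = -1)
    {f : MonoidAlgebra k (DihedralGroup m)} :
    f ∈ signIsotypic k (DihedralGroup m) ε ↔
      (∀ i, f.coeff (sr i) = 0) ∧ ∀ i, f.coeff (r (-i)) = -f.coeff (r i) := by
  rw [mem_signIsotypic]
  constructor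
  · refine fun h => ⟨fun i => ?_, fun i => ?_⟩
    · have := h (sr i) (sr i)
      rw [hεsr] at this
      simp only [inv_sr, sr_mul_self, one_mul] at this
      exact self_eq_neg.mp (by simpa using this)
    · simpa [hεsr] using h (sr 0) (r i)
  · rintro ⟨hs, hr⟩ (i | i) (j | j) <;> simp [hs, hr, hεr, hεsr]

/-- A sign-isotypic element is determined by its coefficients at the rotations `r ^ p` with
`1 ≤ p ≤ (m - 1) / 2`. -/
theorem eq_zero_of_mem_signIsotypic {m : ℕ} [NeZero m] {k : Type*} [Field k] [CharZero k]
    {ε : DihedralGroup m → k} (hεr : ∀ i, ε (r i) = 1) (hεsr : ∀ i, ε (sr i) = -1)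
    {f : MonoidAlgebra k (DihedralGroup m)} (hf : f ∈ signIsotypic k (DihedralGroup m) ε)
    (h : ∀ p : ℕ, 1 ≤ p → p ≤ (m - 1) / 2 → f.coeff (r p) = 0) : f = 0 := by
  obtain ⟨hs, hr⟩ := (mem_signIsotypic_dihedralGroup hεr hεsr).mp hf
  have hodd (i : ZMod m) (hi : -i = i) : f.coeff (r i) = 0 :=
    self_eq_neg.mp (by simpa [hi] using hr i)
  ext g
  rcases g with i | i
  · obtain ⟨n, hn, rfl⟩ : ∃ n < m, (n : ZMod m) = i :=
      ⟨i.val, i.val_lt, ZMod.natCast_zmod_val i⟩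
    have hneg : ((m - n : ℕ) : ZMod m) = -n := by simp [Nat.cast_sub hn.le]
    rcases Nat.eq_zero_or_pos n with rfl | hpos
    · exact hodd _ (by simp)
    rcases lt_trichotomy (2 * n) m with hlt | heq | hgt
    · exact h n hpos (by omega)
    · refine hodd _ ?_
      rw [← hneg]
      congr 1
      omega
    · have := h (m - n) (by omega) (by omega)
      rwa [hneg, hr, neg_eq_zero] at this
  · exact hs i

theorem DihedralGroup.mem_centralizer_r {m : ℕ} {i : ZMod m} (hi : i ≠ -i)
    {g : DihedralGroup m} :
    g ∈ Subgroup.centralizer {(r i : DihedralGroup m)} ↔ ∃ j, g = r j := by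
  rw [Subgroup.mem_centralizer_singleton_iff]
  rcases g with j | j
  · simp [add_comm]
  · simp only [sr_mul_r, r_mul_sr, sr.injEq, reduceCtorEq, exists_false, iff_false]
    exact fun h => hi (add_left_cancel (h.trans (sub_eq_add_neg j i)))

/-- A sum over the cosets of the rotation subgroup has two terms. -/
theorem DihedralGroup.finsum_quotient_centralizer_r {m : ℕ} {i : ZMod m} (hi : i ≠ -i)
    {M : Type*} [AddCommMonoid M] (F : DihedralGroup m → M) {a b : M}
    (ha : ∀ j, F (r j) = a) (hb : ∀ j, F (sr j) = b) :
    ∑ᶠ x : DihedralGroup m ⧸ Subgroup.centralizer {(r i : DihedralGroup m)}, F x.out = a + b := by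
  set H := Subgroup.centralizer {(r i : DihedralGroup m)}
  have hmem {g : DihedralGroup m} : g ∈ H ↔ ∃ j, g = r j := mem_centralizer_r hi
  have hne : ((r 0 : DihedralGroup m) : DihedralGroup m ⧸ H) ≠ (sr 0 : DihedralGroup m) := by
    rw [Ne, QuotientGroup.eq, hmem]
    simp
  have huniv : (Set.univ : Set (DihedralGroup m ⧸ H)) =
      {((r 0 : DihedralGroup m) : DihedralGroup m ⧸ H), ((sr 0 : DihedralGroup m) : DihedralGroup m ⧸ H)} := by
    refine (Set.eq_univ_of_forall fun x => ?_).symm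
    induction x using QuotientGroup.induction_on with
    | H g =>
      rw [Set.mem_insert_iff, Set.mem_singleton_iff, QuotientGroup.eq, QuotientGroup.eq, hmem, hmem]
      rcases g with j | j <;> simp
  rw [← finsum_mem_univ, huniv, finsum_mem_pair hne]
  obtain ⟨⟨g, hg⟩, h₁⟩ := QuotientGroup.mk_out_eq_mul H (r 0)
  obtain ⟨⟨g', hg'⟩, h₂⟩ := QuotientGroup.mk_out_eq_mul H (sr 0)
  obtain ⟨j, rfl⟩ := hmem.mp hg
  obtain ⟨j', rfl⟩ := hmem.mp hg'
  rw [h₁, h₂, r_mul_r, sr_mul_r, ha, hb]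

theorem ZMod.natCast_ne_neg_natCast {m p q : ℕ} (hp : 1 ≤ p) (hp' : p ≤ (m - 1) / 2)
    (hq : q ≤ (m - 1) / 2) : (p : ZMod m) ≠ -q := by
  rw [Ne, eq_neg_iff_add_eq_zero, ← Nat.cast_add, ZMod.natCast_eq_zero_iff]
  exact fun h => absurd (Nat.le_of_dvd (by omega) h) (by omega)

/-- Let `m ≥ 3`, let `W` be the dihedral group of order `2m`, and let
`ε : W → kˣ` be the group homomorphism equal to `1` on all rotations and to `−1` on all
reflections.  Then the sign-isotypic subspace of `k[W]` under the conjugation action has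
dimension `⌊(m−1)/2⌋` over `k`; a basis is given by the elements
`∑_{w' ∈ W/C_W((st)^p)} ε(w')·w'(st)^p w'⁻¹` for `p = 1, …, ⌊(m−1)/2⌋`, where `st = r`. -/
theorem dynkin_stmt6 (m : ℕ) (hm : 3 ≤ m) {k : Type*} [Field k] [CharZero k]
    (ε : DihedralGroup m →* kˣ)
    (hεr : ∀ i, ε (DihedralGroup.r i) = 1) (hεsr : ∀ i, ε (DihedralGroup.sr i) = -1)
    (A : ℕ → MonoidAlgebra k (DihedralGroup m))
    (hA : ∀ p, A p = ∑ᶠ x : DihedralGroup m ⧸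
          Subgroup.centralizer {(DihedralGroup.r 1 : DihedralGroup m) ^ p},
        ((ε x.out : k)) • MonoidAlgebra.of k (DihedralGroup m)
          (x.out * (DihedralGroup.r 1 : DihedralGroup m) ^ p * x.out⁻¹)) :
    Module.finrank k (signIsotypic k (DihedralGroup m) (fun w => (ε w : k))) = (m - 1) / 2 ∧
    LinearIndependent k
      (fun p : {p : ℕ // 1 ≤ p ∧ p ≤ (m - 1) / 2} => A p.1) ∧
    Submodule.span k (Set.range (fun p : {p : ℕ // 1 ≤ p ∧ p ≤ (m - 1) / 2} => A p.1)) =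
      signIsotypic k (DihedralGroup m) (fun w => (ε w : k)) := by
  classical
  have : NeZero m := ⟨by omega⟩
  set V := signIsotypic k (DihedralGroup m) (fun w => (ε w : k))
  have hεr' (i) : ((ε (r i) : kˣ) : k) = 1 := by simp [hεr]
  have hεsr' (i) : ((ε (sr i) : kˣ) : k) = -1 := by simp [hεsr]
  let I := {p : ℕ // 1 ≤ p ∧ p ≤ (m - 1) / 2}
  let e : I ≃ Finset.Icc 1 ((m - 1) / 2) := Equiv.subtypeEquivRight fun p => Finset.mem_Icc.symm
  let : Fintype I := Fintype.ofEquiv _ e.symm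
  have hcard : Fintype.card I = (m - 1) / 2 := by
    rw [Fintype.card_congr e, Fintype.card_coe, Nat.card_Icc, Nat.add_sub_cancel]
  have hA' (p : I) : A p = MonoidAlgebra.single (r (p : ZMod m)) 1 -
      MonoidAlgebra.single (r (-p : ZMod m)) 1 := by
    rw [hA, r_one_pow, sub_eq_add_neg]
    refine finsum_quotient_centralizer_r
      (ZMod.natCast_ne_neg_natCast p.2.1 p.2.2 p.2.2)
      (fun w => (ε w : k) • MonoidAlgebra.of k _ (w * r (p : ZMod m) * w⁻¹))
      (fun j => ?_) fun j => ?_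
    · simp [hεr]
    · simp [hεsr]
  have hAV (p : I) : A p ∈ V := by
    refine (mem_signIsotypic_dihedralGroup hεr' hεsr').mpr ⟨fun i => ?_, fun i => ?_⟩
    · simp [hA']
    · simp [hA', Finsupp.single_apply, neg_eq_iff_eq_neg]
  have hAcoeff (p q : I) : (A p).coeff (r (q : ZMod m)) = if p = q then 1 else 0 := by
    have hinj : (p : ZMod m) = (q : ZMod m) ↔ p = q := by
      rw [ZMod.natCast_eq_natCast_iff', Nat.mod_eq_of_lt, Nat.mod_eq_of_lt, Subtype.ext_iff]
      · have := q.2; omega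
      · have := p.2; omega
    have hneg : -(p : ZMod m) ≠ q := fun h =>
      ZMod.natCast_ne_neg_natCast q.2.1 q.2.2 p.2.2 h.symm
    simp [hA', Finsupp.single_apply, hinj, hneg]
  have hcomb (c : I → k) (q : I) :
      (∑ p, c p • A p).coeff (r (q : ZMod m)) = c q := by
    simp only [MonoidAlgebra.coeff_sum, Finsupp.finsetSum_apply, MonoidAlgebra.coeff_smul_apply,
      hAcoeff, smul_eq_mul, mul_ite, mul_one, mul_zero]
    exact Fintype.sum_ite_eq' q c
  have hli : LinearIndependent k (fun p : I => A p) := by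
    refine Fintype.linearIndependent_iff.mpr fun c hc q => ?_
    rw [← hcomb c q, hc]
    simp
  have hspan : Submodule.span k (Set.range fun p : I => A p) = V := by
    refine le_antisymm (Submodule.span_le.mpr (Set.range_subset_iff.mpr hAV)) fun f hf => ?_
    have hsum : f - ∑ p : I, f.coeff (r (p : ZMod m)) • A p = 0 := by
      refine eq_zero_of_mem_signIsotypic hεr' hεsr'
        (V.sub_mem hf (V.sum_mem fun p _ => V.smul_mem _ (hAV p))) fun p hp hp' => ?_
      rw [MonoidAlgebra.coeff_sub, Finsupp.sub_apply,
        hcomb (fun p : I => f.coeff (r (p : ZMod m))) ⟨p, hp, hp'⟩, sub_self]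
    rw [sub_eq_zero.mp hsum]
    exact Submodule.sum_mem _ fun p _ =>
      Submodule.smul_mem _ _ (Submodule.subset_span (Set.mem_range_self p))
  refine ⟨?_, hli, hspan⟩
  rw [← hspan, finrank_span_eq_card hli, hcard]
end

section
/- Let σ be a permutation of a finite set of m elements (σ ∈ Equiv.Perm (Fin m)). Then the sign character is trivial on the centraliser of σ (i.e., sign(τ) = 1 for every τ commuting with σ) if and only if every cycle of σ has odd length, the lengths of the (nontrivial) cycles of σ are pairwise distinct, and σ has at most one fixed point. Equivalently: the cycle type of σ, with fixed points counted as parts equal to 1, is a partition of m into pairwise distinct odd parts. -/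
/-- Let `σ` be a permutation of a finite set of `m` elements.  Then the sign
character is trivial on the centraliser of `σ` (i.e. `sign τ = 1` for every `τ` commuting
with `σ`) if and only if every cycle of `σ` has odd length, the lengths of the (nontrivial)
cycles of `σ` are pairwise distinct, and `σ` has at most one fixed point.  (Equivalently, the
cycle type of `σ` with fixed points counted as parts equal to `1` is a partition of `m` into
pairwise distinct odd parts.) -/
theorem dynkin_stmt7 (m : ℕ) (σ : Equiv.Perm (Fin m)) :
    (∀ τ : Equiv.Perm (Fin m), Commute τ σ → Equiv.Perm.sign τ = 1) ↔
      ((∀ l ∈ σ.cycleType, Odd l) ∧ σ.cycleType.Nodup ∧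
        {x : Fin m | σ x = x}.Subsingleton) := by
  have h_centralizer : (∀ τ : Equiv.Perm (Fin m), Commute τ σ → Equiv.Perm.sign τ = 1) ↔
      Subgroup.centralizer {σ} ≤ alternatingGroup (Fin m) := by
    simp only [SetLike.le_def, Subgroup.mem_centralizer_singleton_iff,
      Equiv.Perm.mem_alternatingGroup, commute_iff_eq]
  have h_fixed : Fintype.card (Fin m) ≤ σ.cycleType.sum + 1 ↔
      {x : Fin m | σ x = x}.Subsingleton := by
    change _ ↔ (Function.fixedPoints σ).Subsingleton
    rw [← Set.subsingleton_coe, ← Fintype.card_le_one_iff_subsingleton,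
      Equiv.Perm.card_fixedPoints]
    omega
  rw [h_centralizer, Equiv.Perm.centralizer_le_alternating_iff, h_fixed,
    Multiset.nodup_iff_count_le_one]
  tauto
end

section
/- Let p ≥ 1 and let H_p be the hyperoctahedral group. Let c ∈ Perm(Fin p) be the p-cycle (0 1 ⋯ p−1) and let g ∈ H_p be the element whose vector part is ε_{p−1} (the generator of ZMod 2 in the last coordinate) and whose permutation part is c. Then g has order 2p, and the centraliser of g in H_p is exactly the cyclic subgroup generated by g. -/
/-- The action of the symmetric group on `Fin n → Multiplicative (ZMod 2)` by permuting
coordinates: `σ · t = t ∘ σ⁻¹`. -/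
def hyperPhi (n : ℕ) :
    Equiv.Perm (Fin n) →* MulAut (Fin n → Multiplicative (ZMod 2)) where
  toFun σ := MulEquiv.arrowCongr σ (MulEquiv.refl (Multiplicative (ZMod 2)))
  map_one' := by apply MulEquiv.ext; intro t; rfl
  map_mul' σ τ := by apply MulEquiv.ext; intro t; rfl

/-- The hyperoctahedral group `H_n = (Fin n → Multiplicative (ZMod 2)) ⋊ Perm (Fin n)`,
where `Perm (Fin n)` acts by permuting coordinates. -/
abbrev Hyper (n : ℕ) : Type :=
  (Fin n → Multiplicative (ZMod 2)) ⋊[hyperPhi n] Equiv.Perm (Fin n)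

section RegularCyclic

variable {G α : Type*} [Group G] [MulAction G α] [FaithfulSMul G α] {g : G} {x : α}

/-- An element of the centraliser of a transitive cyclic subgroup is determined by the image of
a single point. -/
theorem eq_of_smul_eq_of_commute (hx : ∀ y : α, ∃ k : ℕ, g ^ k • x = y) {a b : G}
    (ha : Commute g a) (hb : Commute g b) (hab : a • x = b • x) : a = b := by
  refine eq_of_smul_eq_smul (α := α) fun y => ?_
  obtain ⟨k, rfl⟩ := hx y
  rw [smul_smul, smul_smul, ← (ha.pow_left k).eq, ← (hb.pow_left k).eq, mul_smul, mul_smul, hab]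

theorem centralizer_eq_zpowers_of_transitive (hx : ∀ y : α, ∃ k : ℕ, g ^ k • x = y) :
    Subgroup.centralizer {g} = Subgroup.zpowers g := by
  ext a
  rw [Subgroup.mem_centralizer_singleton_iff]
  constructor
  · intro ha
    obtain ⟨k, hk⟩ := hx (a • x)
    rw [← eq_of_smul_eq_of_commute hx (Commute.self_pow g k) ha.symm hk]
    exact Subgroup.npow_mem_zpowers g k
  · rintro ⟨k, rfl⟩
    exact (Commute.self_zpow g k).symm.eq

theorem orderOf_eq_card_of_transitive (hx : ∀ y : α, ∃ k : ℕ, g ^ k • x = y) :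
    orderOf g = Nat.card α := by
  rw [← Nat.card_zpowers]
  refine Nat.card_eq_of_bijective (fun a : Subgroup.zpowers g => (a : G) • x) ⟨?_, fun y => ?_⟩
  · rintro ⟨_, k, rfl⟩ ⟨_, l, rfl⟩ h
    exact Subtype.ext
      (eq_of_smul_eq_of_commute hx (Commute.self_zpow g k) (Commute.self_zpow g l) h)
  · obtain ⟨k, hk⟩ := hx y
    exact ⟨⟨g ^ k, Subgroup.npow_mem_zpowers g k⟩, hk⟩

end RegularCyclic

theorem hyperPhi_apply {n : ℕ} (σ : Equiv.Perm (Fin n)) (t : Fin n → Multiplicative (ZMod 2))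
    (i : Fin n) : hyperPhi n σ t i = t (σ.symm i) := rfl

/-- The hyperoctahedral group acts on the signed points `(i, s)`. -/
instance hyperMulAction (n : ℕ) : MulAction (Hyper n) (Fin n × Multiplicative (ZMod 2)) where
  smul h x := (h.right x.1, h.left (h.right x.1) * x.2)
  one_smul x := Prod.ext rfl (one_mul x.2)
  mul_smul a b x := by
    refine Prod.ext rfl ?_
    change (a * b).left ((a * b).right x.1) * x.2 =
      a.left (a.right (b.right x.1)) * (b.left (b.right x.1) * x.2)
    simp [hyperPhi_apply, mul_assoc]

theorem hyper_smul_def {n : ℕ} (h : Hyper n) (x : Fin n × Multiplicative (ZMod 2)) :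
    h • x = (h.right x.1, h.left (h.right x.1) * x.2) := rfl

instance hyperFaithfulSMul (n : ℕ) :
    FaithfulSMul (Hyper n) (Fin n × Multiplicative (ZMod 2)) where
  eq_of_smul_eq_smul {a b} hab := by
    have hr : a.right = b.right := Equiv.ext fun i => congrArg Prod.fst (hab (i, 1))
    refine SemidirectProduct.ext (funext fun i => ?_) hr
    have h := congrArg Prod.snd (hab (a.right.symm i, 1))
    simpa [hyper_smul_def, ← hr] using h

/-- The Coxeter element: the `n + 1`-cycle with a sign change in the last coordinate. -/
def negativeCycle (n : ℕ) : Hyper (n + 1) :=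
  ⟨Pi.mulSingle (Fin.last n) (Multiplicative.ofAdd (1 : ZMod 2)), finRotate (n + 1)⟩

theorem negativeCycle_smul {n : ℕ} (i : Fin (n + 1)) (s : Multiplicative (ZMod 2)) :
    negativeCycle n • (i, s) =
      (i + 1, if i + 1 = Fin.last n then Multiplicative.ofAdd 1 * s else s) := by
  refine Prod.ext (finRotate_apply i) ?_
  simp only [negativeCycle, hyper_smul_def, finRotate_apply, Pi.mulSingle_apply]
  split_ifs <;> simp

theorem negativeCycle_pow_succ_smul_last {n k : ℕ} (hk : k < n) (s : Multiplicative (ZMod 2)) :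
    negativeCycle n ^ (k + 1) • (Fin.last n, s) = ((⟨k, by omega⟩ : Fin (n + 1)), s) := by
  induction k with
  | zero =>
    have h : (0 : Fin (n + 1)) ≠ Fin.last n := by
      simpa [Fin.ext_iff] using hk.ne
    simp [negativeCycle_smul, h]
  | succ k ih =>
    have h : (⟨k, by omega⟩ : Fin (n + 1)) + 1 = ⟨k + 1, by omega⟩ := by
      rw [← finRotate_apply]
      exact finRotate_of_lt (by omega)
    rw [pow_succ', mul_smul, ih (by omega), negativeCycle_smul, h, if_neg]
    simpa [Fin.ext_iff] using hk.ne

theorem negativeCycle_pow_card_smul_last {n : ℕ} (s : Multiplicative (ZMod 2)) :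
    negativeCycle n ^ (n + 1) • (Fin.last n, s) = (Fin.last n, Multiplicative.ofAdd 1 * s) := by
  cases n with
  | zero => simp [negativeCycle_smul]
  | succ m =>
    have h : (⟨m, by omega⟩ : Fin (m + 2)) + 1 = Fin.last (m + 1) := by
      rw [← finRotate_apply]
      exact finRotate_of_lt (by omega)
    rw [pow_succ', mul_smul, negativeCycle_pow_succ_smul_last (by omega), negativeCycle_smul, h,
      if_pos rfl]

theorem negativeCycle_transitive {n : ℕ} (y : Fin (n + 1) × Multiplicative (ZMod 2)) :
    ∃ k : ℕ, negativeCycle n ^ k • (Fin.last n, (1 : Multiplicative (ZMod 2))) = y := by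
  obtain ⟨i, s⟩ := y
  have hs : ∃ k : ℕ, negativeCycle n ^ k • (Fin.last n, (1 : Multiplicative (ZMod 2))) =
      (Fin.last n, s) := by
    have h : s = 1 ∨ s = Multiplicative.ofAdd 1 := by
      revert s
      decide
    rcases h with rfl | rfl
    · exact ⟨0, by rw [pow_zero, one_smul]⟩
    · exact ⟨n + 1, by rw [negativeCycle_pow_card_smul_last, mul_one]⟩
  have hi : ∃ k : ℕ, negativeCycle n ^ k • (Fin.last n, s) = (i, s) := by
    rcases (Fin.le_last i).eq_or_lt with rfl | h
    · exact ⟨0, by rw [pow_zero, one_smul]⟩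
    · exact ⟨i + 1, negativeCycle_pow_succ_smul_last h s⟩
  obtain ⟨k, hk⟩ := hs
  obtain ⟨l, hl⟩ := hi
  exact ⟨l + k, by rw [pow_add, mul_smul, hk, hl]⟩

/-- Let `p ≥ 1` and let `H_p` be the hyperoctahedral group.  Let
`c ∈ Perm (Fin p)` be the `p`-cycle `(0 1 ⋯ p−1)` and let `g ∈ H_p` be the element whose
vector part is `ε_{p−1}` (the generator of `ZMod 2` in the last coordinate) and whose
permutation part is `c`.  Then `g` has order `2p`, and the centraliser of `g` in `H_p` is
exactly the cyclic subgroup generated by `g`. -/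
theorem dynkin_stmt9 (p : ℕ) (hp : 1 ≤ p) (g : Hyper p)
    (hg : g = ⟨Pi.mulSingle (⟨p - 1, by omega⟩ : Fin p) (Multiplicative.ofAdd (1 : ZMod 2)),
      finRotate p⟩) :
    orderOf g = 2 * p ∧ Subgroup.centralizer {g} = Subgroup.zpowers g := by
  obtain ⟨n, rfl⟩ := Nat.exists_eq_add_of_le' hp
  obtain rfl : g = negativeCycle n := hg
  refine ⟨?_, centralizer_eq_zpowers_of_transitive negativeCycle_transitive⟩
  rw [orderOf_eq_card_of_transitive negativeCycle_transitive, Nat.card_prod, Nat.card_fin,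
    Nat.card_congr Multiplicative.toAdd, Nat.card_zmod, mul_comm]
end

section
/- Let Q be an abelian group, G a group acting on Q by automorphisms, and W = Q ⋊ G the semidirect product. For v ∈ G, let Q_v ≤ Q be the subgroup {q·(v·q)⁻¹ : q ∈ Q}. Then two elements (t,v) and (t',v') of W are conjugate in W if and only if there exists x ∈ G with x v x⁻¹ = v' and t'·(x·t)⁻¹ ∈ Q_{v'}. In particular, representatives of the conjugacy classes of W are given by the elements (t,v), where v runs over representatives of the conjugacy classes of G and t runs over representatives of the orbits of the centraliser C_G(v) on Q/Q_v. -/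
/-- For an abelian group `Q` with an action of `G` by automorphisms and `v ∈ G`, the subgroup
`Q_v = {q · (v·q)⁻¹ : q ∈ Q}` of `Q`. -/
def Qsub {Q G : Type*} [CommGroup Q] [Group G] (phi : G →* MulAut Q) (v : G) :
    Subgroup Q where
  carrier := {x | ∃ q : Q, x = q * (phi v q)⁻¹}
  one_mem' := ⟨1, by simp⟩
  mul_mem' := by
    rintro a b ⟨qa, rfl⟩ ⟨qb, rfl⟩
    exact ⟨qa * qb, by rw [map_mul, mul_inv]; exact (mul_mul_mul_comm _ _ _ _).symm⟩
  inv_mem' := by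
    rintro a ⟨q, rfl⟩
    exact ⟨q⁻¹, by rw [map_inv, inv_inv, mul_inv, inv_inv, mul_comm]⟩

/-- Let `Q` be an abelian group, `G` a group acting on `Q` by automorphisms,
and `W = Q ⋊ G`.  For `v ∈ G` let `Q_v ≤ Q` be the subgroup `{q·(v·q)⁻¹ : q ∈ Q}`.  Then two
elements `(t,v)` and `(t',v')` of `W` are conjugate in `W` if and only if there exists
`x ∈ G` with `x v x⁻¹ = v'` and `t'·(x·t)⁻¹ ∈ Q_{v'}`.  (In particular, representatives of
the conjugacy classes of `W` are given by the elements `(t,v)`, where `v` runs over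
representatives of the conjugacy classes of `G` and `t` runs over representatives of the
orbits of `C_G(v)` on `Q/Q_v`.) -/
theorem dynkin_stmt14 {Q G : Type*} [CommGroup Q] [Group G] (phi : G →* MulAut Q)
    (t t' : Q) (v v' : G) :
    IsConj (⟨t, v⟩ : Q ⋊[phi] G) (⟨t', v'⟩ : Q ⋊[phi] G) ↔
      ∃ x : G, x * v * x⁻¹ = v' ∧ t' * (phi x t)⁻¹ ∈ Qsub phi v' := by
  have mem_iff (x : G) : t' * (phi x t)⁻¹ ∈ Qsub phi v' ↔
      ∃ q : Q, q * phi x t = t' * phi v' q := by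
    change (∃ q : Q, t' * (phi x t)⁻¹ = q * (phi v' q)⁻¹) ↔ _
    refine exists_congr fun q => ?_
    rw [← div_eq_mul_inv, ← div_eq_mul_inv, div_eq_div_iff_mul_eq_mul, eq_comm]
  simp only [isConj_iff, mul_inv_eq_iff_eq_mul, SemidirectProduct.ext_iff,
    SemidirectProduct.mul_left, SemidirectProduct.mul_right, mem_iff]
  exact ⟨fun ⟨w, hl, hr⟩ => ⟨w.right, hr, w.left, hl⟩,
    fun ⟨x, hr, q, hl⟩ => ⟨⟨q, x⟩, hl, hr⟩⟩
end

section
/- Let m ≥ 2 and let σ ∈ Equiv.Perm (Fin m) be a permutation having at least two distinct fixed points. Then the alternating sum ∑_{w ∈ Perm(Fin m)} sign(w)·(w σ w⁻¹) is zero in the group algebra k[Perm(Fin m)]. -/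
/-- Let `m ≥ 2` and let `σ ∈ Perm (Fin m)` be a permutation having at least two
distinct fixed points.  Then the alternating sum `∑_{w ∈ Perm (Fin m)} sign(w)·(w σ w⁻¹)` is
zero in the group algebra `k[Perm (Fin m)]`. -/
theorem dynkin_stmt16 {k : Type*} [Field k] [CharZero k] (m : ℕ) (hm : 2 ≤ m)
    (σ : Equiv.Perm (Fin m)) (a b : Fin m) (hab : a ≠ b) (ha : σ a = a) (hb : σ b = b) :
    ∑ w : Equiv.Perm (Fin m),
      ((Equiv.Perm.sign w : ℤ) : k) •
        MonoidAlgebra.of k (Equiv.Perm (Fin m)) (w * σ * w⁻¹) = 0 := by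
  have hcomm : σ * Equiv.swap a b = Equiv.swap a b * σ := by
    rw [Equiv.mul_swap_eq_swap_mul, ha, hb]
  have hconj (w : Equiv.Perm (Fin m)) :
      w * Equiv.swap a b * σ * (w * Equiv.swap a b)⁻¹ = w * σ * w⁻¹ := by
    rw [mul_assoc w, ← hcomm]
    group
  refine Finset.sum_involution (fun w _ => w * Equiv.swap a b) (fun w _ => ?_) (fun w _ _ h => ?_)
    (fun _ _ => Finset.mem_univ _) (fun w _ => Equiv.mul_swap_mul_self a b w)
  · rw [hconj, ← add_smul]
    simp [Equiv.Perm.sign_swap hab]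
  · exact hab (Equiv.swap_eq_one_iff.mp (mul_eq_left.mp h))
end

section
/- Let σ ∈ Equiv.Perm (Fin m) be a permutation whose nontrivial cycles have pairwise distinct lengths (its cycle type is a multiset with no repeated entries) and which has at most one fixed point. Then the centraliser of σ in Perm(Fin m) equals the subgroup generated by the cycle factors of σ; equivalently, every permutation commuting with σ is a product of powers of the disjoint cycles of σ. -/
/-- If the cycle type of `g` has no repeated entries, then every permutation commuting with `g`
commutes with each cycle of `g`. -/
theorem Equiv.Perm.ker_toPermHom_eq_top_of_nodup_cycleType {α : Type*} [Fintype α] [DecidableEq α]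
    {g : Equiv.Perm α} (hg : g.cycleType.Nodup) :
    (Equiv.Perm.OnCycleFactors.toPermHom g).ker = ⊤ := by
  rw [eq_top_iff]
  intro k _
  rw [MonoidHom.mem_ker]
  ext1 c
  rw [Equiv.Perm.cycleType_def] at hg
  refine Subtype.ext (Multiset.inj_on_of_nodup_map hg _ (Subtype.prop _) _ c.prop ?_)
  simp [Equiv.Perm.OnCycleFactors.coe_toPermHom]

/-- If `g` has at most one fixed point, then the permutations preserving each cycle of `g` and
commuting with it are those generated by the cycles of `g`. -/
theorem Equiv.Perm.kerParam_range_eq_closure {α : Type*} [Fintype α] [DecidableEq α]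
    {g : Equiv.Perm α} (hg : (Function.fixedPoints g).Subsingleton) :
    (Equiv.Perm.OnCycleFactors.kerParam g).range =
      Subgroup.closure (g.cycleFactorsFinset : Set (Equiv.Perm α)) := by
  have := hg.coe_sort
  have hbot : (Equiv.Perm.ofSubtype (p := (· ∈ Function.fixedPoints g))).range = ⊥ := by
    rw [MonoidHom.range_eq_bot_iff]
    ext1 u
    rw [Subsingleton.elim u 1, map_one, map_one]
  rw [Equiv.Perm.OnCycleFactors.kerParam, MonoidHom.noncommCoprod_range, hbot, bot_sup_eq,
    Subgroup.noncommPiCoprod_range]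
  simp only [Subgroup.zpowers_eq_closure, ← Subgroup.closure_iUnion]
  congr 1
  ext c
  simp

/-- Let `σ ∈ Perm (Fin m)` be a permutation whose nontrivial cycles have
pairwise distinct lengths (its cycle type is a multiset with no repeated entries) and which
has at most one fixed point.  Then the centraliser of `σ` in `Perm (Fin m)` equals the
subgroup generated by the cycle factors of `σ`; equivalently, every permutation commuting
with `σ` is a product of powers of the disjoint cycles of `σ`. -/
theorem dynkin_stmt17 (m : ℕ) (σ : Equiv.Perm (Fin m))
    (h1 : σ.cycleType.Nodup) (h2 : {x : Fin m | σ x = x}.Subsingleton) :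
    Subgroup.centralizer {σ} =
      Subgroup.closure (σ.cycleFactorsFinset : Set (Equiv.Perm (Fin m))) := by
  rw [← Equiv.Perm.kerParam_range_eq_closure h2, Equiv.Perm.OnCycleFactors.kerParam_range_eq,
    Equiv.Perm.ker_toPermHom_eq_top_of_nodup_cycleType h1, ← MonoidHom.range_eq_map,
    Subgroup.range_subtype]
end
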